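/- arXiv:1902.02368 — 2 statements merged into one kernel-verified Lean document; each statement's English description precedes it below -/
import Mathlib

section
/- Minimum principle for supersolutions of the hyperbolic system: let F, R : [0,∞)² → ℝ be continuous on [0,∞)² and continuously differentiable on (0,∞)². Assume F(x,0) ≥ 0 and F(0,y) ≥ 0 for all x,y ≥ 0, that liminf of F(r,s) as r²+s² → ∞ is ≥ 0, and that for every y ≥ 0, R(r,y) → 0 as r → ∞. Assume further that on (0,∞)² the supersolution inequalities hold: ∂ₓF(x,y) − 2∂_yF(x,y) ≤ (2/tanh x)·F(x,y) − (2/sinh x)·R(x,y) and ∂ₓR(x,y) ≤ −(2/sinh x)·F(x,y) + (2/tanh x)·R(x,y). Then F(x,y) ≥ 0 and R(x,y) ≥ 0 for all x,y ≥ 0. -/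
open Real

/-- If `f' ≤ 2 coth · f + 2 m / sinh` on the positive half-line and `f → 0` at infinity,
then `f` is bounded below by `-m`. -/
lemma neg_le_of_deriv_le_of_tendsto_zero {f : ℝ → ℝ} {m : ℝ} (hm : 0 ≤ m)
    (hf : ∀ x, 0 < x → DifferentiableAt ℝ f x)
    (hf' : ∀ x, 0 < x → deriv f x ≤ 2 / sinh x * m + 2 / tanh x * f x)
    (hlim : Filter.Tendsto f Filter.atTop (nhds 0)) {x : ℝ} (hx : 0 < x) : -m ≤ f x := by
  have hderiv : ∀ t, 0 < t → HasDerivAt (fun t => (f t + m) / sinh t ^ 2)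
      ((deriv f t * sinh t ^ 2 - (f t + m) * (2 * sinh t * cosh t)) / (sinh t ^ 2) ^ 2) t := by
    intro t ht
    have hs : sinh t ^ 2 ≠ 0 := pow_ne_zero _ (sinh_pos_iff.2 ht).ne'
    have h2 : HasDerivAt (fun t => sinh t ^ 2) (2 * sinh t * cosh t) t := by
      simpa using (hasDerivAt_sinh t).fun_pow 2
    exact ((hf t ht).hasDerivAt.add_const m).div h2 hs
  have hanti : AntitoneOn (fun t => (f t + m) / sinh t ^ 2) (Set.Ioi 0) := by
    refine antitoneOn_of_deriv_nonpos (convex_Ioi 0)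
      (fun t ht => (hderiv t ht).continuousAt.continuousWithinAt) ?_ ?_
    · intro t ht
      rw [interior_Ioi] at ht
      exact (hderiv t ht).differentiableAt.differentiableWithinAt
    · intro t ht
      rw [interior_Ioi] at ht
      rw [(hderiv t ht).deriv]
      have hs : 0 < sinh t := sinh_pos_iff.2 ht
      have h := hf' t ht
      refine div_nonpos_of_nonpos_of_nonneg ?_ (by positivity)
      have e : (2 / sinh t * m + 2 / tanh t * f t) * sinh t ^ 2
          = 2 * m * sinh t + 2 * cosh t * sinh t * f t := by
        rw [tanh_eq_sinh_div_cosh]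
        field_simp
      have h1 := mul_le_mul_of_nonneg_right h (sq_nonneg (sinh t))
      rw [e] at h1
      nlinarith [mul_nonneg (mul_nonneg hm hs.le) (sub_nonneg.2 (one_le_cosh t))]
  have hsinh : Filter.Tendsto sinh Filter.atTop Filter.atTop :=
    Filter.tendsto_atTop_mono' _
      (Filter.eventually_ge_atTop 0 |>.mono fun t ht => self_le_sinh_iff.2 ht) Filter.tendsto_id
  have hzero : Filter.Tendsto (fun t => (f t + m) / sinh t ^ 2) Filter.atTop (nhds 0) :=
    (hlim.add_const m).div_atTop ((Filter.tendsto_pow_atTop two_ne_zero).comp hsinh)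
  have hnonneg : 0 ≤ (f x + m) / sinh x ^ 2 :=
    le_of_tendsto hzero <| (Filter.eventually_ge_atTop x).mono fun t ht =>
      hanti hx (hx.trans_le ht) ht
  have hs : 0 < sinh x ^ 2 := pow_pos (sinh_pos_iff.2 hx) 2
  rw [le_div_iff₀ hs, zero_mul] at hnonneg
  linarith

/-- A continuous function on the closed quadrant that is nonnegative on the axes, asymptotically
nonnegative at infinity and negative somewhere attains a negative minimum in the open quadrant. -/
lemma exists_neg_min_of_quadrant {F : ℝ → ℝ → ℝ}
    (hFcont : ContinuousOn (fun p : ℝ × ℝ => F p.1 p.2) (Set.Ici 0 ×ˢ Set.Ici 0))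
    (hFx0 : ∀ x : ℝ, 0 ≤ x → 0 ≤ F x 0)
    (hF0y : ∀ y : ℝ, 0 ≤ y → 0 ≤ F 0 y)
    (hliminf : ∀ ε : ℝ, 0 < ε → ∃ M : ℝ, ∀ r s : ℝ, 0 ≤ r → 0 ≤ s →
      M ≤ r ^ 2 + s ^ 2 → -ε ≤ F r s)
    {a b : ℝ} (ha : 0 ≤ a) (hb : 0 ≤ b) (hab : F a b < 0) :
    ∃ x y : ℝ, 0 < x ∧ 0 < y ∧ F x y < 0 ∧ ∀ r s : ℝ, 0 ≤ r → 0 ≤ s → F x y ≤ F r s := by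
  obtain ⟨M, hM⟩ := hliminf (-F a b) (by linarith)
  set K : ℝ := |M| + 1 + a + b with hK
  have hMK := le_abs_self M
  have hM0 := abs_nonneg M
  obtain ⟨⟨x, y⟩, ⟨⟨hx, -⟩, ⟨hy, -⟩⟩, hmin⟩ :=
    (isCompact_Icc (a := (0 : ℝ)) (b := K)).prod (isCompact_Icc (a := (0 : ℝ)) (b := K))
      |>.exists_isMinOn ⟨(a, b), ⟨ha, by linarith⟩, ⟨hb, by linarith⟩⟩
        (hFcont.mono (Set.prod_mono Set.Icc_subset_Ici_self Set.Icc_subset_Ici_self))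
  dsimp only at hx hy
  have hxyab : F x y ≤ F a b :=
    hmin (a := (a, b)) ⟨⟨ha, by linarith⟩, ⟨hb, by linarith⟩⟩
  have hneg : F x y < 0 := hxyab.trans_lt hab
  refine ⟨x, y, hx.lt_of_ne ?_, hy.lt_of_ne ?_, hneg, fun r s hr hs => ?_⟩
  · rintro rfl
    exact (hF0y y hy).not_gt hneg
  · rintro rfl
    exact (hFx0 x hx).not_gt hneg
  · by_cases h : r ≤ K ∧ s ≤ K
    · exact hmin (a := (r, s)) ⟨⟨hr, h.1⟩, ⟨hs, h.2⟩⟩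
    · have hfar : M ≤ r ^ 2 + s ^ 2 := by
        rcases not_and_or.1 h with h | h <;> nlinarith
      linarith [hM r s hr hs hfar]

/-- minimum principle for supersolutions of the hyperbolic system. -/
theorem min_principle_hyperbolic_system (F R : ℝ → ℝ → ℝ)
    (hFcont : ContinuousOn (fun p : ℝ × ℝ => F p.1 p.2) (Set.Ici 0 ×ˢ Set.Ici 0))
    (hRcont : ContinuousOn (fun p : ℝ × ℝ => R p.1 p.2) (Set.Ici 0 ×ˢ Set.Ici 0))
    (hFdiff : ContDiffOn ℝ 1 (fun p : ℝ × ℝ => F p.1 p.2) (Set.Ioi 0 ×ˢ Set.Ioi 0))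
    (hRdiff : ContDiffOn ℝ 1 (fun p : ℝ × ℝ => R p.1 p.2) (Set.Ioi 0 ×ˢ Set.Ioi 0))
    (hFx0 : ∀ x : ℝ, 0 ≤ x → 0 ≤ F x 0)
    (hF0y : ∀ y : ℝ, 0 ≤ y → 0 ≤ F 0 y)
    (hliminf : ∀ ε : ℝ, 0 < ε → ∃ M : ℝ, ∀ r s : ℝ, 0 ≤ r → 0 ≤ s →
      M ≤ r ^ 2 + s ^ 2 → -ε ≤ F r s)
    (hRlim : ∀ y : ℝ, 0 ≤ y →
      Filter.Tendsto (fun r => R r y) Filter.atTop (nhds 0))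
    (hFsuper : ∀ x y : ℝ, 0 < x → 0 < y →
      deriv (fun t => F t y) x - 2 * deriv (fun t => F x t) y
        ≤ (2 / Real.tanh x) * F x y - (2 / Real.sinh x) * R x y)
    (hRsuper : ∀ x y : ℝ, 0 < x → 0 < y →
      deriv (fun t => R t y) x
        ≤ -(2 / Real.sinh x) * F x y + (2 / Real.tanh x) * R x y) :
    ∀ x y : ℝ, 0 ≤ x → 0 ≤ y → 0 ≤ F x y ∧ 0 ≤ R x y := by
  have hRd : ∀ x y : ℝ, 0 < x → 0 < y → DifferentiableAt ℝ (fun t => R t y) x := by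
    intro x y hx hy
    have h : DifferentiableAt ℝ (fun p : ℝ × ℝ => R p.1 p.2) (x, y) :=
      (hRdiff.differentiableOn one_ne_zero).differentiableAt
        ((isOpen_Ioi.prod isOpen_Ioi).mem_nhds ⟨hx, hy⟩)
    exact h.comp (f := fun t : ℝ => (t, y)) x (by fun_prop)
  have hRlower : ∀ m : ℝ, 0 ≤ m → (∀ x y : ℝ, 0 ≤ x → 0 ≤ y → -m ≤ F x y) →
      ∀ x y : ℝ, 0 < x → 0 < y → -m ≤ R x y := by
    intro m hm hF x y hx hy
    refine neg_le_of_deriv_le_of_tendsto_zero (f := fun t => R t y) hm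
      (fun t ht => hRd t y ht hy) (fun t ht => ?_) (hRlim y hy.le) hx
    have hs : 0 ≤ 2 / sinh t := (div_pos two_pos (sinh_pos_iff.2 ht)).le
    nlinarith [hRsuper t y ht hy, mul_le_mul_of_nonneg_left (hF t y ht.le hy.le) hs]
  have hF : ∀ x y : ℝ, 0 ≤ x → 0 ≤ y → 0 ≤ F x y := by
    by_contra! hcon
    obtain ⟨a, b, ha, hb, hab⟩ := hcon
    obtain ⟨x, y, hx, hy, hneg, hmin⟩ :=
      exists_neg_min_of_quadrant hFcont hFx0 hF0y hliminf ha hb hab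
    have hdx : deriv (fun t => F t y) x = 0 :=
      IsLocalMin.deriv_eq_zero <| (lt_mem_nhds hx).mono fun t ht => hmin t y ht.le hy.le
    have hdy : deriv (fun t => F x t) y = 0 :=
      IsLocalMin.deriv_eq_zero <| (lt_mem_nhds hy).mono fun t ht => hmin x t hx.le ht.le
    have hR := hRlower (-F x y) (by linarith) (by simpa using hmin) x y hx hy
    have h := hFsuper x y hx hy
    have hs : 0 < sinh x := sinh_pos_iff.2 hx
    have e : (2 / tanh x) * F x y - (2 / sinh x) * R x y
        = 2 / sinh x * (cosh x * F x y - R x y) := by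
      rw [tanh_eq_sinh_div_cosh]
      field_simp
    rw [hdx, hdy, e] at h
    have h0 : 0 ≤ cosh x * F x y - R x y :=
      nonneg_of_mul_nonneg_right (by linarith) (div_pos two_pos hs)
    nlinarith [one_lt_cosh.2 hx.ne']
  intro x y hx hy
  refine ⟨hF x y hx hy, ?_⟩
  have hmem : (x, y) ∈ closure (Set.Ioi (0 : ℝ) ×ˢ Set.Ioi (0 : ℝ)) := by
    rw [closure_prod_eq, closure_Ioi]
    exact ⟨hx, hy⟩
  refine ContinuousWithinAt.closure_le (f := fun _ => (0 : ℝ))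
    (g := fun p : ℝ × ℝ => R p.1 p.2) hmem continuousWithinAt_const
    ((hRcont (x, y) ⟨hx, hy⟩).mono
      (Set.prod_mono Set.Ioi_subset_Ici_self Set.Ioi_subset_Ici_self)) fun p hp => ?_
  simpa using hRlower 0 le_rfl (by simpa using hF) p.1 p.2 hp.1 hp.2
end

section
/- The pair (V₁, V₂) solves the coupled system: for all x > 0, (√2/sinh(√2 x))·V₁(x) − (√2/tanh(√2 x))·V₂(x) = −1/2, and −(√2/tanh(√2 x))·V₁(x) + (√2/sinh(√2 x))·V₂(x) + V₁′(x)/2 = 0, where V₁′ denotes the derivative of V₁. -/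
open Real

/-- `V₁(x) = (1/√2)·arctan(e^{−√2 x})·cosh²(√2 x) − sinh(√2 x)/(2√2)`. -/
noncomputable def V1 (x : ℝ) : ℝ :=
  (1 / Real.sqrt 2) * Real.arctan (Real.exp (-(Real.sqrt 2 * x))) * Real.cosh (Real.sqrt 2 * x) ^ 2
    - Real.sinh (Real.sqrt 2 * x) / (2 * Real.sqrt 2)

/-- `V₂(x) = (1/√2)·arctan(e^{−√2 x})·cosh(√2 x)`. -/
noncomputable def V2 (x : ℝ) : ℝ :=
  (1 / Real.sqrt 2) * Real.arctan (Real.exp (-(Real.sqrt 2 * x))) * Real.cosh (Real.sqrt 2 * x)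

theorem hasDerivAt_arctan_exp_neg (y : ℝ) :
    HasDerivAt (fun y => Real.arctan (Real.exp (-y))) (-(1 / (2 * Real.cosh y))) y := by
  have h := ((hasDerivAt_neg y).exp).arctan
  refine h.congr_deriv ?_
  have hc := Real.cosh_pos y
  have he : Real.exp (-y) * Real.exp y = 1 := by rw [← Real.exp_add]; simp
  have h2 : 1 + Real.exp (-y) ^ 2 = 2 * Real.cosh y * Real.exp (-y) := by
    rw [Real.cosh_eq]; linear_combination -he
  have hp := Real.exp_pos (-y)
  rw [h2]
  field_simp

theorem hasDerivAt_V1 (x : ℝ) :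
    HasDerivAt V1 (2 * Real.arctan (Real.exp (-(Real.sqrt 2 * x))) * Real.cosh (Real.sqrt 2 * x)
      * Real.sinh (Real.sqrt 2 * x) - Real.cosh (Real.sqrt 2 * x)) x := by
  have hr : Real.sqrt 2 ≠ 0 := by positivity
  have hy : HasDerivAt (fun x : ℝ => Real.sqrt 2 * x) (Real.sqrt 2) x := by
    simpa using (hasDerivAt_id' x).const_mul (Real.sqrt 2)
  have hA := (hasDerivAt_arctan_exp_neg (Real.sqrt 2 * x)).comp x hy
  have h := ((hA.const_mul (1 / Real.sqrt 2)).mul (hy.cosh.pow 2)).sub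
    (hy.sinh.div_const (2 * Real.sqrt 2))
  have hc := (Real.cosh_pos (Real.sqrt 2 * x)).ne'
  refine HasDerivAt.congr_deriv (f := V1) h ?_
  simp only [Function.comp_apply, Pi.pow_apply]
  field_simp
  ring

/-- `(V₁, V₂)` solves the coupled system. -/
theorem V1_V2_coupled_system (x : ℝ) (hx : 0 < x) :
    (Real.sqrt 2 / Real.sinh (Real.sqrt 2 * x)) * V1 x
      - (Real.sqrt 2 / Real.tanh (Real.sqrt 2 * x)) * V2 x = -(1/2) ∧
    -(Real.sqrt 2 / Real.tanh (Real.sqrt 2 * x)) * V1 x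
      + (Real.sqrt 2 / Real.sinh (Real.sqrt 2 * x)) * V2 x + deriv V1 x / 2 = 0 := by
  have hr : Real.sqrt 2 ≠ 0 := by positivity
  have hs : Real.sinh (Real.sqrt 2 * x) ≠ 0 := (Real.sinh_pos_iff.mpr (by positivity)).ne'
  have hc := (Real.cosh_pos (Real.sqrt 2 * x)).ne'
  have hcs := Real.cosh_sq (Real.sqrt 2 * x)
  rw [(hasDerivAt_V1 x).deriv, Real.tanh_eq_sinh_div_cosh, V1, V2]
  generalize Real.arctan (Real.exp (-(Real.sqrt 2 * x))) = A
  generalize Real.sinh (Real.sqrt 2 * x) = s at *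
  generalize Real.cosh (Real.sqrt 2 * x) = c at *
  constructor
  · field_simp
    ring
  · field_simp
    linear_combination (-2 * A * c) * hcs
end
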